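/- arXiv:2102.03030 — 4 statements merged into one kernel-verified Lean document; each statement's English description precedes it below -/
import Mathlib

section
/- For every natural number n ≥ 1, the expected gain satisfies g(n) = e^n · n^{-n} · ∫_{n}^{∞} t^n e^{-t} dt − 1, where the integral is the upper incomplete Gamma function Γ(n+1, n). -/
open Finset Real Filter

/-- Probability mass function of the Mlynar distribution with parameter `n`:
`p_{k,n} = k·(n-1)!/(n^k·(n-k)!)`. -/
noncomputable def mlynarP (n k : ℕ) : ℝ :=
  (k : ℝ) * (Nat.factorial (n - 1)) / ((n : ℝ) ^ k * (Nat.factorial (n - k)))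

theorem integrableOn_pow_mul_exp_neg_Ioi (n : ℕ) (x : ℝ) :
    MeasureTheory.IntegrableOn (fun t : ℝ => t ^ n * Real.exp (-t)) (Set.Ioi x) := by
  refine integrable_of_isBigO_exp_neg (b := 1 / 2) (by norm_num) (by fun_prop) ?_
  have h := (isLittleO_pow_exp_pos_mul_atTop n (b := 1 / 2) (by norm_num)).isBigO.mul
    (Asymptotics.isBigO_refl (fun t : ℝ => Real.exp (-t)) atTop)
  refine h.congr_right fun t => ?_
  rw [← Real.exp_add]
  ring_nf

theorem integral_pow_succ_mul_exp_neg_Ioi (n : ℕ) (x : ℝ) :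
    ∫ t in Set.Ioi x, t ^ (n + 1) * Real.exp (-t) =
      x ^ (n + 1) * Real.exp (-x) + (n + 1) * ∫ t in Set.Ioi x, t ^ n * Real.exp (-t) := by
  have hint := integrableOn_pow_mul_exp_neg_Ioi (n + 1) x
  have hint' := (integrableOn_pow_mul_exp_neg_Ioi n x).const_mul ((n : ℝ) + 1)
  have hderiv (t : ℝ) : HasDerivAt (fun t : ℝ => -(t ^ (n + 1) * Real.exp (-t)))
      (t ^ (n + 1) * Real.exp (-t) - (n + 1) * (t ^ n * Real.exp (-t))) t := by
    refine ((hasDerivAt_pow (n + 1) t).mul (hasDerivAt_neg t).exp).neg.congr_deriv ?_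
    push_cast
    ring
  have hlim : Tendsto (fun t : ℝ => -(t ^ (n + 1) * Real.exp (-t))) atTop (nhds 0) := by
    simpa using (Real.tendsto_pow_mul_exp_neg_atTop_nhds_zero (n + 1)).neg
  have h := MeasureTheory.integral_Ioi_of_hasDerivAt_of_tendsto' (a := x)
    (fun t _ => hderiv t) (hint.sub hint') hlim
  rw [MeasureTheory.integral_sub hint hint', MeasureTheory.integral_const_mul] at h
  linarith

theorem integral_pow_mul_exp_neg_Ioi (n : ℕ) (x : ℝ) :
    ∫ t in Set.Ioi x, t ^ n * Real.exp (-t) =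
      Real.exp (-x) * ∑ j ∈ Finset.range (n + 1), (n.descFactorial j : ℝ) * x ^ (n - j) := by
  induction n with
  | zero => simpa using integral_exp_neg_Ioi x
  | succ n ih =>
    rw [integral_pow_succ_mul_exp_neg_Ioi, ih, Finset.sum_range_succ' _ (n + 1)]
    simp only [Nat.succ_descFactorial_succ, Nat.add_sub_add_right, Nat.descFactorial_zero,
      Nat.sub_zero, Nat.cast_mul, mul_assoc, ← Finset.mul_sum]
    push_cast
    ring

theorem sum_Icc_mul_sub_succ (f : ℕ → ℝ) (m : ℕ) :
    ∑ k ∈ Finset.Icc 1 m, (k : ℝ) * (f k - f (k + 1)) =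
      ∑ k ∈ Finset.Icc 1 m, f k - m * f (m + 1) := by
  induction m with
  | zero => simp
  | succ m ih =>
    rw [Finset.sum_Icc_succ_top (by omega), Finset.sum_Icc_succ_top (by omega), ih]
    push_cast
    ring

theorem mlynarP_eq_sub {n k : ℕ} (hn : 1 ≤ n) (hk : k ≤ n) :
    mlynarP n k =
      (n.descFactorial k : ℝ) / n ^ k - (n.descFactorial (k + 1) : ℝ) / n ^ (k + 1) := by
  have hn0 : (n : ℝ) ≠ 0 := by positivity
  have hf : ((n - k).factorial : ℝ) ≠ 0 := by positivity
  have hfac : (n : ℝ) * (n - 1).factorial = (n - k).factorial * n.descFactorial k := by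
    exact_mod_cast (Nat.mul_factorial_pred (by omega)).trans
      (Nat.factorial_mul_descFactorial hk).symm
  rw [mlynarP, Nat.descFactorial_succ, Nat.cast_mul, Nat.cast_sub hk]
  field_simp
  linear_combination (k : ℝ) * (n : ℝ) ^ k * hfac

theorem mlynar_expectation_incGamma (n : ℕ) (hn : 1 ≤ n) :
    ∑ k ∈ Finset.Icc 1 n, (k : ℝ) * mlynarP n k =
      Real.exp n * (n : ℝ) ^ (-(n : ℤ)) *
        (∫ t in Set.Ioi (n : ℝ), t ^ n * Real.exp (-t)) - 1 := by
  have hn0 : (n : ℝ) ≠ 0 := by positivity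
  have hgain : ∑ k ∈ Finset.Icc 1 n, (k : ℝ) * mlynarP n k =
      ∑ k ∈ Finset.Icc 1 n, (n.descFactorial k : ℝ) / n ^ k := by
    rw [Finset.sum_congr rfl fun k hk => by rw [mlynarP_eq_sub hn (Finset.mem_Icc.mp hk).2],
      sum_Icc_mul_sub_succ (fun k => (n.descFactorial k : ℝ) / n ^ k)]
    simp
  have hsum : (n : ℝ) ^ (-(n : ℤ)) *
      ∑ j ∈ Finset.range (n + 1), (n.descFactorial j : ℝ) * (n : ℝ) ^ (n - j) =
      ∑ j ∈ Finset.range (n + 1), (n.descFactorial j : ℝ) / n ^ j := by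
    rw [Finset.mul_sum]
    refine Finset.sum_congr rfl fun j hj => ?_
    rw [pow_sub₀ _ hn0 (Nat.lt_succ_iff.mp (Finset.mem_range.mp hj)), zpow_neg, zpow_natCast]
    field_simp
  rw [hgain, integral_pow_mul_exp_neg_Ioi, mul_mul_mul_comm, ← Real.exp_add, add_neg_cancel,
    Real.exp_zero, one_mul, hsum, Finset.range_eq_Ico, Finset.sum_eq_sum_Ico_succ_bot (by omega)]
  simp [← Finset.Ico_add_one_right_eq_Icc]
end

section
/- The expected gain satisfies the refined asymptotic lim_{n→∞} ( g(n) − √(nπ/2) ) = −1/3; equivalently, g(n) = √(nπ/2) − 1/3 + o(1) as n → ∞. -/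
open Finset Real Filter

open MeasureTheory Topology

lemma nonneg_of_hasDerivAt_nonneg {f f' : ℝ → ℝ} (hf : ∀ x, 0 ≤ x → HasDerivAt f (f' x) x)
    (hf' : ∀ x, 0 ≤ x → 0 ≤ f' x) (h0 : f 0 = 0) {x : ℝ} (hx : 0 ≤ x) : 0 ≤ f x := by
  have hmono : MonotoneOn f (Set.Ici 0) := by
    refine monotoneOn_of_deriv_nonneg (convex_Ici 0)
      (fun y hy => (hf y hy).continuousAt.continuousWithinAt) ?_ ?_
    · intro y hy
      rw [interior_Ici] at hy
      exact (hf y (le_of_lt hy)).differentiableAt.differentiableWithinAt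
    · intro y hy
      rw [interior_Ici] at hy
      rw [(hf y (le_of_lt hy)).deriv]
      exact hf' y (le_of_lt hy)
  simpa [h0] using hmono (Set.mem_Ici.2 le_rfl) hx hx

lemma hasDerivAt_log_one_add {x : ℝ} (hx : 0 ≤ x) :
    HasDerivAt (fun y => log (1 + y)) (1 / (1 + x)) x :=
  ((hasDerivAt_id' x).const_add 1).log (by positivity)

lemma log_one_add_le_cubic {x : ℝ} (hx : 0 ≤ x) :
    log (1 + x) ≤ x - x ^ 2 / 2 + x ^ 3 / 3 := by
  have h := nonneg_of_hasDerivAt_nonneg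
    (f := fun y => y - y ^ 2 / 2 + y ^ 3 / 3 - log (1 + y)) (f' := fun y => y ^ 3 / (1 + y))
    (fun y hy => by
      have h := ((((hasDerivAt_id' y).sub ((hasDerivAt_pow 2 y).div_const 2)).add
        ((hasDerivAt_pow 3 y).div_const 3)).sub (hasDerivAt_log_one_add hy))
      refine h.congr_deriv ?_
      have : 1 + y ≠ 0 := by positivity
      field_simp
      push_cast
      ring)
    (fun y hy => by positivity) (by simp) hx
  linarith

lemma quartic_le_log_one_add {x : ℝ} (hx : 0 ≤ x) :
    x - x ^ 2 / 2 + x ^ 3 / 3 - x ^ 4 / 4 ≤ log (1 + x) := by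
  have h := nonneg_of_hasDerivAt_nonneg
    (f := fun y => log (1 + y) - (y - y ^ 2 / 2 + y ^ 3 / 3 - y ^ 4 / 4))
    (f' := fun y => y ^ 4 / (1 + y))
    (fun y hy => by
      have h := (hasDerivAt_log_one_add hy).sub
        ((((hasDerivAt_id' y).sub ((hasDerivAt_pow 2 y).div_const 2)).add
        ((hasDerivAt_pow 3 y).div_const 3)).sub ((hasDerivAt_pow 4 y).div_const 4))
      refine h.congr_deriv ?_
      have : 1 + y ≠ 0 := by positivity
      field_simp
      push_cast
      ring)
    (fun y hy => by positivity) (by simp) hx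
  linarith

lemma quadratic_le_log_one_add {x : ℝ} (hx : 0 ≤ x) : x - x ^ 2 / 2 ≤ log (1 + x) := by
  refine le_trans ?_ (le_log_one_add_of_nonneg hx)
  rw [le_div_iff₀ (by positivity)]
  nlinarith [pow_nonneg hx 3]

lemma log_one_add_le_sub_div {x : ℝ} (hx : 0 ≤ x) :
    log (1 + x) ≤ x - x ^ 2 / (2 * (1 + x)) := by
  have h := nonneg_of_hasDerivAt_nonneg
    (f := fun y => ((1 + y) - (1 + y)⁻¹) / 2 - log (1 + y))
    (f' := fun y => (y / (1 + y)) ^ 2 / 2)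
    (fun y hy => by
      have hy' : 1 + y ≠ 0 := by positivity
      have h1 := (hasDerivAt_id' y).const_add 1
      have h := ((h1.sub (h1.inv hy')).div_const 2).sub (hasDerivAt_log_one_add hy)
      refine h.congr_deriv ?_
      field_simp
      ring)
    (fun y hy => by positivity) (by simp) hx
  have hx' : 1 + x ≠ 0 := by positivity
  have : x - x ^ 2 / (2 * (1 + x)) = ((1 + x) - (1 + x)⁻¹) / 2 := by
    field_simp
    ring
  linarith

/-- The correction to the Gaussian exponent `-t ^ 2 / 2` in
`exp (-s * t) * (1 + t / s) ^ (s ^ 2 - 1)`. -/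
noncomputable def exponentCorrection (s t : ℝ) : ℝ :=
  s ^ 2 * (log (1 + t / s) - t / s + (t / s) ^ 2 / 2) - log (1 + t / s)

lemma mul_exponentCorrection_le {s t : ℝ} (hs : 0 < s) (ht : 0 ≤ t) :
    s * exponentCorrection s t ≤ t ^ 3 / 3 - t + t ^ 2 / 2 / s := by
  have hx : 0 ≤ t / s := by positivity
  have h1 := mul_le_mul_of_nonneg_left (log_one_add_le_cubic hx) (pow_nonneg hs.le 3)
  have h2 := mul_le_mul_of_nonneg_left (quadratic_le_log_one_add hx) hs.le
  have e1 : t ^ 3 / 3 - t + t ^ 2 / 2 / s =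
      s ^ 3 * (t / s - (t / s) ^ 2 / 2 + (t / s) ^ 3 / 3)
        - s ^ 3 * (t / s - (t / s) ^ 2 / 2) - s * (t / s - (t / s) ^ 2 / 2) := by
    field_simp
    ring
  rw [e1, exponentCorrection]
  linarith

lemma le_mul_exponentCorrection {s t : ℝ} (hs : 0 < s) (ht : 0 ≤ t) :
    t ^ 3 / 3 - t - t ^ 4 / 4 / s ≤ s * exponentCorrection s t := by
  have hx : 0 ≤ t / s := by positivity
  have h1 := mul_le_mul_of_nonneg_left (quartic_le_log_one_add hx) (pow_nonneg hs.le 3)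
  have h2 := mul_le_mul_of_nonneg_left
    ((log_le_sub_one_of_pos (by positivity : 0 < 1 + t / s))) hs.le
  have e1 : t ^ 3 / 3 - t - t ^ 4 / 4 / s =
      s ^ 3 * (t / s - (t / s) ^ 2 / 2 + (t / s) ^ 3 / 3 - (t / s) ^ 4 / 4)
        - s ^ 3 * (t / s - (t / s) ^ 2 / 2) - s * (1 + t / s - 1) := by
    field_simp
    ring
  rw [e1, exponentCorrection]
  linarith

lemma abs_mul_exponentCorrection_le {s t : ℝ} (hs : 0 < s) (ht : 0 ≤ t) :
    |s * exponentCorrection s t| ≤ t ^ 3 / 3 + t := by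
  have hx : 0 ≤ t / s := by positivity
  have a1 := mul_le_mul_of_nonneg_left (log_one_add_le_cubic hx) (pow_nonneg hs.le 3)
  have a2 := mul_le_mul_of_nonneg_left (quadratic_le_log_one_add hx) (pow_nonneg hs.le 3)
  have b1 := mul_nonneg hs.le (log_nonneg (by linarith : 1 ≤ 1 + t / s))
  have b2 := mul_le_mul_of_nonneg_left
    ((log_le_sub_one_of_pos (by positivity : 0 < 1 + t / s))) hs.le
  have e1 : t ^ 3 / 3 = s ^ 3 * (t / s - (t / s) ^ 2 / 2 + (t / s) ^ 3 / 3)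
        - s ^ 3 * (t / s - (t / s) ^ 2 / 2) := by
    field_simp
    ring
  have e2 : t = s * (1 + t / s - 1) := by field_simp; ring
  have ht3 : 0 ≤ t ^ 3 / 3 := by positivity
  rw [exponentCorrection, abs_le]
  constructor <;> linarith

lemma gaussian_add_exponentCorrection_le {s t : ℝ} (hs : 1 ≤ s) (ht : 0 ≤ t) :
    -t ^ 2 / 2 + exponentCorrection s t ≤ 1 / 2 - t / 2 := by
  have hs0 : 0 < s := by linarith
  have hx : 0 ≤ t / s := by positivity
  have hlog := log_nonneg (by linarith : 1 ≤ 1 + t / s)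
  have h1 := mul_le_mul_of_nonneg_left (log_one_add_le_sub_div hx) (pow_nonneg hs0.le 2)
  have e1 : -t ^ 2 / 2 + exponentCorrection s t
      = s ^ 2 * log (1 + t / s) - s ^ 2 * (t / s) - log (1 + t / s) := by
    rw [exponentCorrection]
    field_simp
    ring
  have e2 : s ^ 2 * ((t / s) ^ 2 / (2 * (1 + t / s))) = t ^ 2 / (2 * (1 + t / s)) := by
    field_simp
  have hle : t / s ≤ t := div_le_self ht hs
  have h2 : (t - 1) / 2 ≤ t ^ 2 / (2 * (1 + t / s)) := by
    calc (t - 1) / 2 ≤ t ^ 2 / (2 * (1 + t)) := by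
          rw [div_le_div_iff₀ (by norm_num) (by positivity)]
          nlinarith
      _ ≤ t ^ 2 / (2 * (1 + t / s)) := by gcongr
  rw [e1]
  linarith

lemma tendsto_mul_exponentCorrection {t : ℝ} (ht : 0 ≤ t) :
    Tendsto (fun s => s * exponentCorrection s t) atTop (𝓝 (t ^ 3 / 3 - t)) := by
  have hz (c : ℝ) : Tendsto (fun s : ℝ => c / s) atTop (𝓝 0) := tendsto_id.const_div_atTop c
  refine tendsto_of_tendsto_of_tendsto_of_le_of_le'
    (g := fun s => t ^ 3 / 3 - t - t ^ 4 / 4 / s)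
    (h := fun s => t ^ 3 / 3 - t + t ^ 2 / 2 / s) ?_ ?_ ?_ ?_
  · simpa using (hz (t ^ 4 / 4)).const_sub (t ^ 3 / 3 - t)
  · simpa using (hz (t ^ 2 / 2)).const_add (t ^ 3 / 3 - t)
  · filter_upwards [eventually_gt_atTop 0] with s hs using le_mul_exponentCorrection hs ht
  · filter_upwards [eventually_gt_atTop 0] with s hs using mul_exponentCorrection_le hs ht

lemma tendsto_mul_exp_sub_one {d : ℝ → ℝ} {c : ℝ}
    (hd : Tendsto (fun s => s * d s) atTop (𝓝 c)) :
    Tendsto (fun s => s * (exp (d s) - 1)) atTop (𝓝 c) := by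
  have h0 : Tendsto d atTop (𝓝 0) := by
    have h := hd.mul tendsto_inv_atTop_zero
    rw [mul_zero] at h
    refine h.congr' ?_
    filter_upwards [eventually_ne_atTop 0] with s hs
    field_simp
  have herr : Tendsto (fun s => s * (exp (d s) - 1 - d s)) atTop (𝓝 0) := by
    refine squeeze_zero_norm' (a := fun s => |s * d s| * |d s|) ?_
      (by simpa using hd.abs.mul h0.abs)
    filter_upwards [h0.abs.eventually_le_const (by norm_num : |(0 : ℝ)| < 1)] with s hs
    have h := abs_exp_sub_one_sub_id_le hs
    rw [norm_eq_abs, abs_mul, abs_mul, mul_assoc, abs_mul_abs_self, ← pow_two]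
    gcongr
  have h := herr.add hd
  rw [zero_add] at h
  exact h.congr fun s => by ring

lemma abs_exp_sub_exp_le {a b c : ℝ} (ha : a ≤ c) (hb : b ≤ c) :
    |exp a - exp b| ≤ |a - b| * exp c := by
  wlog hab : b ≤ a generalizing a b
  · rw [abs_sub_comm, abs_sub_comm a]
    exact this hb ha (le_of_not_ge hab)
  rw [abs_of_nonneg (sub_nonneg.2 (exp_le_exp.2 hab)), abs_of_nonneg (sub_nonneg.2 hab)]
  have h := mul_le_mul_of_nonneg_right (add_one_le_exp (b - a)) (exp_pos a).le
  rw [← exp_add, sub_add_cancel] at h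
  have h2 := mul_le_mul_of_nonneg_left (exp_le_exp.2 ha) (sub_nonneg.2 hab)
  linarith

lemma integrableOn_pow_mul_exp_neg_mul (k : ℕ) {r : ℝ} (hr : 0 < r) :
    IntegrableOn (fun t : ℝ => t ^ k * exp (-r * t)) (Set.Ioi 0) := by
  simpa using integrableOn_rpow_mul_exp_neg_mul_rpow (p := 1) (s := k) (b := r)
    (by linarith [Nat.cast_nonneg (α := ℝ) k]) one_pos hr

lemma integral_pow_mul_exp_neg_mul (k : ℕ) {r : ℝ} (hr : 0 < r) :
    ∫ t in Set.Ioi (0 : ℝ), t ^ k * exp (-r * t) = k.factorial / r ^ (k + 1) := by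
  have h := integral_rpow_mul_exp_neg_mul_Ioi (a := (k + 1 : ℕ)) (by positivity) hr
  rw [rpow_natCast, Nat.cast_add_one, Gamma_nat_eq_factorial, add_sub_cancel_right] at h
  simp only [rpow_natCast] at h
  simp only [neg_mul, h]
  rw [one_div, inv_pow]
  field_simp

lemma integrableOn_pow_mul_exp_neg_sq (k : ℕ) :
    IntegrableOn (fun t : ℝ => t ^ k * exp (-t ^ 2 / 2)) (Set.Ioi 0) := by
  have h := integrableOn_rpow_mul_exp_neg_mul_sq (b := 1 / 2) (by norm_num) (s := k)
    (by linarith [Nat.cast_nonneg (α := ℝ) k])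
  simp only [rpow_natCast] at h
  convert h using 4
  ring

lemma integral_cubic_mul_gaussian :
    ∫ t in Set.Ioi (0 : ℝ), (t ^ 3 / 3 - t) * exp (-t ^ 2 / 2) = -1 / 3 := by
  have hint : IntegrableOn (fun t : ℝ => (t ^ 3 / 3 - t) * exp (-t ^ 2 / 2)) (Set.Ioi 0) := by
    have h := ((integrableOn_pow_mul_exp_neg_sq 3).div_const 3).sub
      (integrableOn_pow_mul_exp_neg_sq 1)
    refine IntegrableOn.congr_fun h (fun t _ => ?_) measurableSet_Ioi
    simp only [Pi.sub_apply]
    ring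
  have hlim : Tendsto (fun t : ℝ => (1 / 3 - t ^ 2 / 3) * exp (-t ^ 2 / 2)) atTop (𝓝 0) := by
    have hu : Tendsto (fun t : ℝ => t ^ 2 / 2) atTop atTop :=
      (tendsto_pow_atTop two_ne_zero).atTop_div_const two_pos
    have h0 := (tendsto_pow_mul_exp_neg_atTop_nhds_zero 0).comp hu
    have h1 := (tendsto_pow_mul_exp_neg_atTop_nhds_zero 1).comp hu
    have h := (h0.div_const 3).sub (h1.const_mul (2 / 3))
    rw [zero_div, mul_zero, sub_zero] at h
    refine h.congr fun t => ?_
    simp only [Function.comp_apply, neg_div]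
    ring
  rw [integral_Ioi_of_hasDerivAt_of_tendsto' (m := 0) (fun t _ => ?_) hint hlim]
  · norm_num
  · have h1 : HasDerivAt (fun t : ℝ => 1 / 3 - t ^ 2 / 3) (-(2 * t / 3)) t := by
      refine (((hasDerivAt_pow 2 t).div_const 3).const_sub (1 / 3)).congr_deriv ?_
      norm_num
    have h2 : HasDerivAt (fun t : ℝ => -t ^ 2 / 2) (-t) t := by
      refine (((hasDerivAt_pow 2 t).neg).div_const 2).congr_deriv ?_
      norm_num
      ring
    refine (h1.mul h2.exp).congr_deriv ?_
    ring

lemma tendsto_integral_mul_exp_sub_gaussian :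
    Tendsto (fun s : ℝ => ∫ t in Set.Ioi (0 : ℝ),
        s * (exp (-t ^ 2 / 2 + exponentCorrection s t) - exp (-t ^ 2 / 2)))
      atTop (𝓝 (-1 / 3)) := by
  rw [← integral_cubic_mul_gaussian]
  refine tendsto_integral_filter_of_dominated_convergence
    (fun t => (t ^ 3 / 3 + t) * exp (1 / 2 - t / 2)) ?_ ?_ ?_ ?_
  · refine Eventually.of_forall fun s => Measurable.aestronglyMeasurable ?_
    unfold exponentCorrection
    fun_prop
  · filter_upwards [eventually_ge_atTop 1] with s hs
    refine (ae_restrict_iff' measurableSet_Ioi).2 (Eventually.of_forall fun t ht => ?_)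
    have ht0 : 0 ≤ t := le_of_lt ht
    have hs0 : 0 < s := by linarith
    have h := abs_exp_sub_exp_le (gaussian_add_exponentCorrection_le hs ht0)
      (by nlinarith [sq_nonneg (2 * t - 1)] : -t ^ 2 / 2 ≤ 1 / 2 - t / 2)
    rw [add_sub_cancel_left] at h
    calc ‖s * (exp (-t ^ 2 / 2 + exponentCorrection s t) - exp (-t ^ 2 / 2))‖
        ≤ |s| * (|exponentCorrection s t| * exp (1 / 2 - t / 2)) := by
          rw [norm_eq_abs, abs_mul]
          gcongr
      _ = |s * exponentCorrection s t| * exp (1 / 2 - t / 2) := by rw [abs_mul]; ring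
      _ ≤ _ := by gcongr; exact abs_mul_exponentCorrection_le hs0 ht0
  · have h := (((integrableOn_pow_mul_exp_neg_mul 3 one_half_pos).div_const 3).add
      (integrableOn_pow_mul_exp_neg_mul 1 one_half_pos)).const_mul (exp (1 / 2))
    refine IntegrableOn.congr_fun h (fun t _ => ?_) measurableSet_Ioi
    simp only [Pi.add_apply]
    rw [show 1 / 2 - t / 2 = 1 / 2 + -(1 / 2) * t by ring, exp_add]
    ring
  · refine (ae_restrict_iff' measurableSet_Ioi).2 (Eventually.of_forall fun t ht => ?_)
    have h := (tendsto_mul_exp_sub_one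
      (tendsto_mul_exponentCorrection (le_of_lt ht))).mul_const (exp (-t ^ 2 / 2))
    refine h.congr fun s => ?_
    rw [exp_add]
    ring

lemma exp_gaussian_add_exponentCorrection (m : ℕ) {t : ℝ} (ht : 0 ≤ t) :
    exp (-t ^ 2 / 2 + exponentCorrection √(m + 1) t)
      = exp (-√(m + 1) * t) * (1 + t / √(m + 1)) ^ m := by
  have hs : 0 < √((m : ℝ) + 1) := sqrt_pos.2 (by positivity)
  have hsq : √((m : ℝ) + 1) ^ 2 = m + 1 := sq_sqrt (by positivity)
  have hx : 0 < 1 + t / √((m : ℝ) + 1) := by positivity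
  have hm : (m : ℝ) = √((m : ℝ) + 1) ^ 2 - 1 := by linarith
  rw [← exp_log (pow_pos hx m), ← exp_add, log_pow, exponentCorrection]
  congr 1
  generalize √((m : ℝ) + 1) = s at *
  rw [hm]
  field_simp
  ring

lemma one_add_div_pow_mul_exp_eq_sum (m : ℕ) (s t : ℝ) :
    exp (-s * t) * (1 + t / s) ^ m
      = ∑ k ∈ range (m + 1), (m.choose k / s ^ k) * (t ^ k * exp (-s * t)) := by
  rw [add_comm 1, add_pow, mul_sum]
  refine sum_congr rfl fun k _ => ?_
  rw [one_pow, div_pow]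
  ring

lemma integrableOn_exp_mul_one_add_div_pow (m : ℕ) {s : ℝ} (hs : 0 < s) :
    IntegrableOn (fun t : ℝ => exp (-s * t) * (1 + t / s) ^ m) (Set.Ioi 0) := by
  simp only [one_add_div_pow_mul_exp_eq_sum]
  exact integrable_finsetSum _ fun k _ => (integrableOn_pow_mul_exp_neg_mul k hs).const_mul _

lemma mul_integral_exp_mul_one_add_div_pow (m : ℕ) {s : ℝ} (hs : 0 < s) :
    s * ∫ t in Set.Ioi (0 : ℝ), exp (-s * t) * (1 + t / s) ^ m
      = ∑ k ∈ range (m + 1), (m.descFactorial k : ℝ) / (s ^ 2) ^ k := by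
  simp only [one_add_div_pow_mul_exp_eq_sum]
  rw [integral_finsetSum _ fun k _ => (integrableOn_pow_mul_exp_neg_mul k hs).const_mul _,
    mul_sum]
  refine sum_congr rfl fun k _ => ?_
  rw [integral_const_mul, integral_pow_mul_exp_neg_mul k hs,
    Nat.descFactorial_eq_factorial_mul_choose]
  push_cast
  field_simp
  ring

lemma mlynarP_succ_succ {m k : ℕ} (hk : k ≤ m) :
    mlynarP (m + 1) (k + 1)
      = (m.descFactorial k : ℝ) / (m + 1) ^ k - m.descFactorial (k + 1) / (m + 1) ^ (k + 1) := by
  have hf : ((m - k).factorial : ℝ) ≠ 0 := by positivity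
  have hm : (m : ℝ) + 1 ≠ 0 := by positivity
  have h := Nat.factorial_mul_descFactorial hk
  have h' : (m.factorial : ℝ) = (m - k).factorial * m.descFactorial k := by exact_mod_cast h.symm
  rw [mlynarP, Nat.descFactorial_succ, Nat.add_sub_cancel, Nat.add_sub_add_right, h']
  push_cast [Nat.cast_sub hk]
  field_simp
  ring

lemma sum_range_succ_mul_sub (a : ℕ → ℝ) (m : ℕ) :
    ∑ k ∈ range m, ((k : ℝ) + 1) * (a k - a (k + 1)) = ∑ k ∈ range m, a k - m * a m := by
  induction m with
  | zero => simp
  | succ m ih =>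
    rw [sum_range_succ, ih, sum_range_succ]
    push_cast
    ring

lemma sum_mul_mlynarP (m : ℕ) :
    ∑ k ∈ Finset.Icc 1 (m + 1), (k : ℝ) * mlynarP (m + 1) k
      = ∑ k ∈ range (m + 1), (m.descFactorial k : ℝ) / (m + 1) ^ k := by
  have h := sum_range_succ_mul_sub (fun k => (m.descFactorial k : ℝ) / (m + 1) ^ k) (m + 1)
  rw [Nat.descFactorial_of_lt (Nat.lt_succ_self m), Nat.cast_zero, zero_div, mul_zero,
    sub_zero] at h
  rw [← h, ← Finset.Ico_add_one_right_eq_Icc, Finset.sum_Ico_eq_sum_range]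
  refine sum_congr rfl fun k hk => ?_
  rw [add_comm 1 k, mlynarP_succ_succ (Nat.lt_succ_iff.1 (mem_range.1 hk))]
  push_cast
  rfl

lemma sum_mul_mlynarP_sub_sqrt (m : ℕ) :
    ∑ k ∈ Finset.Icc 1 (m + 1), (k : ℝ) * mlynarP (m + 1) k - √(((m + 1 : ℕ) : ℝ) * π / 2)
      = ∫ t in Set.Ioi (0 : ℝ), √(m + 1) *
          (exp (-t ^ 2 / 2 + exponentCorrection √(m + 1) t) - exp (-t ^ 2 / 2)) := by
  have hs : 0 < √((m : ℝ) + 1) := sqrt_pos.2 (by positivity)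
  have hgauss : ∫ t in Set.Ioi (0 : ℝ), exp (-t ^ 2 / 2) = √(π / 2) := by
    have h := integral_gaussian_Ioi (1 / 2)
    have e : √(π / (1 / 2)) / 2 = √(π / 2) := by
      rw [show π / (1 / 2) = 2 ^ 2 * (π / 2) by ring, sqrt_mul (by norm_num),
        sqrt_sq (by norm_num)]
      ring
    rw [← e, ← h]
    congr 1 with t
    ring_nf
  have hexp : ∫ t in Set.Ioi (0 : ℝ), √((m : ℝ) + 1) *
          (exp (-t ^ 2 / 2 + exponentCorrection √(m + 1) t) - exp (-t ^ 2 / 2))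
      = ∫ t in Set.Ioi (0 : ℝ), √((m : ℝ) + 1) *
          (exp (-√(m + 1) * t) * (1 + t / √(m + 1)) ^ m - exp (-t ^ 2 / 2)) :=
    setIntegral_congr_fun measurableSet_Ioi fun t ht => by
      simp only [exp_gaussian_add_exponentCorrection m (le_of_lt ht)]
  rw [hexp, integral_const_mul, integral_sub (integrableOn_exp_mul_one_add_div_pow m hs)
    (by simpa [IntegrableOn] using integrableOn_pow_mul_exp_neg_sq 0), mul_sub,
    mul_integral_exp_mul_one_add_div_pow m hs, hgauss, sum_mul_mlynarP,
    sq_sqrt (by positivity), ← sqrt_mul (by positivity), mul_div_assoc, Nat.cast_add_one]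

theorem mlynar_expectation_refined_asymptotic :
    Tendsto (fun n : ℕ =>
        (∑ k ∈ Finset.Icc 1 n, (k : ℝ) * mlynarP n k) - Real.sqrt ((n : ℝ) * π / 2))
      atTop (nhds (-1 / 3)) := by
  rw [← tendsto_add_atTop_iff_nat 1]
  have hsqrt : Tendsto (fun m : ℕ => √((m : ℝ) + 1)) atTop atTop :=
    tendsto_sqrt_atTop.comp (tendsto_atTop_add_const_right _ 1 tendsto_natCast_atTop_atTop)
  exact (tendsto_integral_mul_exp_sub_gaussian.comp hsqrt).congr fun m =>
    (sum_mul_mlynarP_sub_sqrt m).symm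
end

section
/- The scaled variance v(n) = Var(G_n)/n converges: lim_{n→∞} (1/n) · ( ∑_{k=1}^{n} k²·p_{k,n} − (∑_{k=1}^{n} k·p_{k,n})² ) = 2 − π/2. -/
open Finset Real Filter

/-- The tail probability `P(G_n ≥ k)` of the Mlynar distribution (for `k ≥ 1`). -/
noncomputable def mlynarTail (n k : ℕ) : ℝ :=
  (n.descFactorial k : ℝ) / (n : ℝ) ^ k

lemma mlynarTail_zero_right (n : ℕ) : mlynarTail n 0 = 1 := by
  simp [mlynarTail]

lemma mlynarTail_eq_zero {n k : ℕ} (h : n < k) : mlynarTail n k = 0 := by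
  simp [mlynarTail, Nat.descFactorial_eq_zero_iff_lt.2 h]

lemma mul_mlynarTail_succ {n : ℕ} (hn : n ≠ 0) (k : ℕ) :
    n * mlynarTail n (k + 1) = (n - k) * mlynarTail n k := by
  rcases le_or_gt k n with hk | hk
  · have hn' : (n : ℝ) ≠ 0 := by exact_mod_cast hn
    simp only [mlynarTail, Nat.descFactorial_succ]
    push_cast [Nat.cast_sub hk]
    field_simp
    ring
  · simp [mlynarTail_eq_zero hk, mlynarTail_eq_zero (Nat.lt_succ_of_lt hk)]

lemma mlynarP_eq_tail_sub {n k : ℕ} (hn : n ≠ 0) (hk : k ≤ n) :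
    mlynarP n k = mlynarTail n k - mlynarTail n (k + 1) := by
  have hn' : (n : ℝ) ≠ 0 := by exact_mod_cast hn
  have hfac : (n.factorial : ℝ) = (n - k).factorial * n.descFactorial k := by
    exact_mod_cast (Nat.factorial_mul_descFactorial hk).symm
  have hpred : (n.factorial : ℝ) = n * (n - 1).factorial := by
    exact_mod_cast (Nat.mul_factorial_pred hn).symm
  have hpos : ((n - k).factorial : ℝ) ≠ 0 := by positivity
  have hp : n * mlynarP n k = k * mlynarTail n k := by
    simp only [mlynarP, mlynarTail]
    field_simp
    linear_combination (k : ℝ) * hfac - k * hpred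
  have hs := mul_mlynarTail_succ hn k
  apply mul_left_cancel₀ hn'
  linear_combination hp + hs

lemma sum_mul_mlynarTail_sub (n m : ℕ) :
    ∑ k ∈ range m, (k : ℝ) * (mlynarTail n k - mlynarTail n (k + 1)) =
      ∑ k ∈ range (m + 1), mlynarTail n k - 1 - m * mlynarTail n m := by
  induction m with
  | zero => simp [mlynarTail_zero_right]
  | succ m ih =>
    rw [sum_range_succ, ih, sum_range_succ _ (m + 1)]
    push_cast
    ring

lemma sum_sq_mul_mlynarTail_sub {n : ℕ} (hn : n ≠ 0) (m : ℕ) :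
    ∑ k ∈ range m, (k : ℝ) ^ 2 * (mlynarTail n k - mlynarTail n (k + 1)) =
      2 * n * (1 - mlynarTail n (m + 1)) - ∑ k ∈ range (m + 1), mlynarTail n k + 1
        - m ^ 2 * mlynarTail n m := by
  induction m with
  | zero =>
    have h := mul_mlynarTail_succ hn 0
    simp only [zero_add, range_zero, sum_empty, sum_range_one, mlynarTail_zero_right,
      Nat.cast_zero] at h ⊢
    linear_combination 2 * h
  | succ m ih =>
    have h := mul_mlynarTail_succ hn (m + 1)
    rw [sum_range_succ, ih, sum_range_succ _ (m + 1)]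
    push_cast at h ⊢
    linear_combination 2 * h

lemma sum_Icc_mul_mlynarP {n : ℕ} (hn : n ≠ 0) (f : ℕ → ℝ) (hf : f 0 = 0) :
    ∑ k ∈ Icc 1 n, f k * mlynarP n k =
      ∑ k ∈ range (n + 1), f k * (mlynarTail n k - mlynarTail n (k + 1)) := by
  rw [sum_range_eq_add_Ico _ n.succ_pos, hf, zero_mul, zero_add]
  refine sum_congr (by ext; simp) fun k hk => ?_
  rw [mlynarP_eq_tail_sub hn (by have := mem_Ico.1 hk; omega)]

lemma mlynar_first_moment {n : ℕ} (hn : n ≠ 0) :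
    ∑ k ∈ Icc 1 n, (k : ℝ) * mlynarP n k = ∑ k ∈ range (n + 1), mlynarTail n k - 1 := by
  rw [sum_Icc_mul_mlynarP hn (fun k => (k : ℝ)) (by simp), sum_mul_mlynarTail_sub,
    sum_range_succ _ (n + 1), mlynarTail_eq_zero n.lt_succ_self]
  ring

lemma mlynar_second_moment {n : ℕ} (hn : n ≠ 0) :
    ∑ k ∈ Icc 1 n, (k : ℝ) ^ 2 * mlynarP n k =
      2 * n + 1 - ∑ k ∈ range (n + 1), mlynarTail n k := by
  rw [sum_Icc_mul_mlynarP hn (fun k => (k : ℝ) ^ 2) (by simp), sum_sq_mul_mlynarTail_sub hn,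
    sum_range_succ _ (n + 1), mlynarTail_eq_zero n.lt_succ_self,
    mlynarTail_eq_zero (by omega : n < n + 1 + 1)]
  ring

lemma integrableOn_exp_neg_mul_pow (k : ℕ) :
    MeasureTheory.IntegrableOn (fun x : ℝ => exp (-x) * x ^ k) (Set.Ioi 0) := by
  simpa using Real.GammaIntegral_convergent (s := (k : ℝ) + 1) (by positivity)

lemma integral_exp_neg_mul_pow (k : ℕ) :
    ∫ x in Set.Ioi (0 : ℝ), exp (-x) * x ^ k = k.factorial := by
  have h := Real.Gamma_eq_integral (s := (k : ℝ) + 1) (by positivity)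
  rw [Real.Gamma_nat_eq_factorial] at h
  simpa using h.symm

lemma integral_exp_neg_mul_one_add_div_pow (n : ℕ) :
    ∫ x in Set.Ioi (0 : ℝ), exp (-x) * (1 + x / n) ^ n =
      ∑ k ∈ range (n + 1), mlynarTail n k := by
  have hexp : ∀ x : ℝ, exp (-x) * (1 + x / n) ^ n =
      ∑ k ∈ range (n + 1), (n.choose k : ℝ) / (n : ℝ) ^ k * (exp (-x) * x ^ k) := by
    intro x
    rw [add_comm 1, add_pow, mul_sum]
    refine sum_congr rfl fun k _ => ?_
    rw [one_pow, div_pow]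
    ring
  simp_rw [hexp]
  rw [MeasureTheory.integral_finsetSum _
    fun k _ => (integrableOn_exp_neg_mul_pow k).const_mul _]
  refine sum_congr rfl fun k _ => ?_
  rw [MeasureTheory.integral_const_mul, integral_exp_neg_mul_pow, mlynarTail,
    Nat.descFactorial_eq_factorial_mul_choose]
  push_cast
  ring

lemma log_one_add_sub_le {s : ℝ} (hs : 0 ≤ s) :
    log (1 + s) - s ≤ -(s ^ 2 / (2 * (1 + s))) := by
  have h : log (1 + s) ≤ ((1 + s) - (1 + s)⁻¹) / 2 := by
    rw [← Real.sinh_log (by positivity)]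
    exact Real.self_le_sinh_iff.2 (Real.log_nonneg (by linarith))
  have e : ((1 + s) - (1 + s)⁻¹) / 2 - s = -(s ^ 2 / (2 * (1 + s))) := by
    field_simp
    ring
  linarith

lemma le_log_one_add_sub {s : ℝ} (hs : 0 ≤ s) :
    -(s ^ 2 / (s + 2)) ≤ log (1 + s) - s := by
  have h := Real.le_log_one_add_of_nonneg hs
  have e : 2 * s / (s + 2) - s = -(s ^ 2 / (s + 2)) := by
    field_simp
    ring
  linarith

/-- The integrand `exp (-x) * (1 + x / n) ^ n` at `x = √n * t`, in exponential form. -/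
lemma exp_neg_mul_one_add_div_pow_sqrt_mul {n : ℕ} (hn : n ≠ 0) {t : ℝ} (ht : 0 ≤ t) :
    exp (-(√n * t)) * (1 + √n * t / n) ^ n = exp (n * (log (1 + t / √n) - t / √n)) := by
  have hn0 : (0 : ℝ) < n := by positivity
  have hsq : √(n : ℝ) * √n = n := Real.mul_self_sqrt hn0.le
  have hs : 0 < √(n : ℝ) := Real.sqrt_pos.2 hn0
  have e : √(n : ℝ) * t / n = t / √n := by
    rw [div_eq_div_iff hn0.ne' hs.ne']
    linear_combination t * hsq
  have e' : √(n : ℝ) * t = n * (t / √n) := by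
    rw [← e]
    field_simp
  rw [e, e', mul_sub, sub_eq_neg_add, Real.exp_add, Real.exp_nat_mul,
    Real.exp_log (by positivity)]

lemma nat_mul_div_sqrt_sq {n : ℕ} (hn : n ≠ 0) (t : ℝ) : n * (t / √n) ^ 2 = t ^ 2 := by
  have hn0 : (0 : ℝ) < n := by positivity
  rw [div_pow, Real.sq_sqrt hn0.le]
  field_simp

lemma nat_mul_log_one_add_sub_le {n : ℕ} (hn : n ≠ 0) {t : ℝ} (ht : 0 ≤ t) :
    n * (log (1 + t / √n) - t / √n) ≤ -(t ^ 2 / (2 * (1 + t / √n))) := by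
  have h := mul_le_mul_of_nonneg_left (log_one_add_sub_le (s := t / √n) (by positivity))
    (Nat.cast_nonneg (α := ℝ) n)
  rwa [mul_neg, ← mul_div_assoc, nat_mul_div_sqrt_sq hn] at h

lemma le_nat_mul_log_one_add_sub {n : ℕ} (hn : n ≠ 0) {t : ℝ} (ht : 0 ≤ t) :
    -(t ^ 2 / (t / √n + 2)) ≤ n * (log (1 + t / √n) - t / √n) := by
  have h := mul_le_mul_of_nonneg_left (le_log_one_add_sub (s := t / √n) (by positivity))
    (Nat.cast_nonneg (α := ℝ) n)
  rwa [mul_neg, ← mul_div_assoc, nat_mul_div_sqrt_sq hn] at h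

lemma tendsto_sqrt_natCast_atTop : Tendsto (fun n : ℕ => √(n : ℝ)) atTop atTop :=
  Real.tendsto_sqrt_atTop.comp tendsto_natCast_atTop_atTop

lemma tendsto_nat_mul_log_one_add_sub {t : ℝ} (ht : 0 ≤ t) :
    Tendsto (fun n : ℕ => n * (log (1 + t / √n) - t / √n)) atTop (nhds (-(t ^ 2 / 2))) := by
  have h0 : Tendsto (fun n : ℕ => t / √(n : ℝ)) atTop (nhds 0) :=
    tendsto_sqrt_natCast_atTop.const_div_atTop t
  have hlow : Tendsto (fun n : ℕ => -(t ^ 2 / (t / √(n : ℝ) + 2))) atTop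
      (nhds (-(t ^ 2 / 2))) := by
    simpa using (tendsto_const_nhds (x := t ^ 2)).div (h0.add_const 2) (by norm_num) |>.neg
  have hupp : Tendsto (fun n : ℕ => -(t ^ 2 / (2 * (1 + t / √(n : ℝ))))) atTop
      (nhds (-(t ^ 2 / 2))) := by
    simpa using (tendsto_const_nhds (x := t ^ 2)).div ((h0.const_add 1).const_mul 2)
      (by norm_num) |>.neg
  refine tendsto_of_tendsto_of_tendsto_of_le_of_le' hlow hupp ?_ ?_ <;>
    filter_upwards [eventually_ne_atTop 0] with n hn
  · exact le_nat_mul_log_one_add_sub hn ht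
  · exact nat_mul_log_one_add_sub_le hn ht

lemma nat_mul_log_one_add_sub_le_linear {n : ℕ} (hn : n ≠ 0) {t : ℝ} (ht : 0 ≤ t) :
    n * (log (1 + t / √n) - t / √n) ≤ 1 / 2 + -(1 / 2) * t := by
  refine (nat_mul_log_one_add_sub_le hn ht).trans ?_
  have h1 : (1 : ℝ) ≤ √n := Real.one_le_sqrt.2 (by exact_mod_cast Nat.one_le_iff_ne_zero.2 hn)
  have h2 : t / √n ≤ t := div_le_self ht h1
  have h3 : t ^ 2 / (2 * (1 + t)) ≤ t ^ 2 / (2 * (1 + t / √n)) := by gcongr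
  have h4 : (t - 1) / 2 ≤ t ^ 2 / (2 * (1 + t)) := by
    rw [div_le_div_iff₀ (by norm_num) (by positivity)]
    nlinarith
  linarith

lemma tendsto_integral_exp_neg_mul_one_add_div_pow :
    Tendsto (fun n : ℕ => ∫ t in Set.Ioi (0 : ℝ), exp (-(√n * t)) * (1 + √n * t / n) ^ n)
      atTop (nhds √(π / 2)) := by
  have hgauss : ∫ t in Set.Ioi (0 : ℝ), exp (-(t ^ 2 / 2)) = √(π / 2) := by
    have h := integral_gaussian_Ioi (1 / 2)
    have e : √(π / (1 / 2)) / 2 = √(π / 2) := by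
      rw [show π / (1 / 2) = 2 ^ 2 * (π / 2) by ring, Real.sqrt_mul (by positivity),
        Real.sqrt_sq (by norm_num)]
      ring
    rw [← e, ← h]
    congr! 3
    ring
  rw [← hgauss]
  refine MeasureTheory.tendsto_integral_filter_of_dominated_convergence
    (fun t => exp (1 / 2 + -(1 / 2) * t)) ?_ ?_ ?_ ?_
  · exact Eventually.of_forall fun n => by fun_prop
  · filter_upwards [eventually_ne_atTop 0] with n hn
    filter_upwards [MeasureTheory.ae_restrict_mem measurableSet_Ioi] with t ht
    rw [exp_neg_mul_one_add_div_pow_sqrt_mul hn (le_of_lt ht), Real.norm_eq_abs, Real.abs_exp]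
    exact Real.exp_le_exp.2 (nat_mul_log_one_add_sub_le_linear hn (le_of_lt ht))
  · simp_rw [Real.exp_add]
    exact (integrableOn_exp_mul_Ioi (by norm_num) 0).const_mul _
  · filter_upwards [MeasureTheory.ae_restrict_mem measurableSet_Ioi] with t ht
    refine ((Real.continuous_exp.tendsto _).comp
      (tendsto_nat_mul_log_one_add_sub (le_of_lt ht))).congr' ?_
    filter_upwards [eventually_ne_atTop 0] with n hn
    exact (exp_neg_mul_one_add_div_pow_sqrt_mul hn (le_of_lt ht)).symm

lemma tendsto_sum_mlynarTail_div_sqrt :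
    Tendsto (fun n : ℕ => (∑ k ∈ range (n + 1), mlynarTail n k) / √n) atTop
      (nhds √(π / 2)) := by
  refine tendsto_integral_exp_neg_mul_one_add_div_pow.congr' ?_
  filter_upwards [eventually_ne_atTop 0] with n hn
  have hs : 0 < √(n : ℝ) := Real.sqrt_pos.2 (by positivity)
  rw [MeasureTheory.integral_comp_mul_left_Ioi (fun x : ℝ => exp (-x) * (1 + x / n) ^ n) 0 hs,
    mul_zero, integral_exp_neg_mul_one_add_div_pow, smul_eq_mul, inv_mul_eq_div]

theorem mlynar_scaled_variance_limit :
    Tendsto (fun n : ℕ => (1 / (n : ℝ)) *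
        ((∑ k ∈ Finset.Icc 1 n, (k : ℝ) ^ 2 * mlynarP n k) -
          (∑ k ∈ Finset.Icc 1 n, (k : ℝ) * mlynarP n k) ^ 2))
      atTop (nhds (2 - π / 2)) := by
  have hinv : Tendsto (fun n : ℕ => 1 / √(n : ℝ)) atTop (nhds 0) :=
    tendsto_sqrt_natCast_atTop.const_div_atTop 1
  have hgain := tendsto_sum_mlynarTail_div_sqrt.sub hinv
  have hlim := ((hgain.mul hinv).const_sub 2).sub (hgain.pow 2)
  rw [mul_zero, sub_zero, sub_zero, Real.sq_sqrt (by positivity)] at hlim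
  refine hlim.congr' ?_
  filter_upwards [eventually_ne_atTop 0] with n hn
  rw [mlynar_first_moment hn, mlynar_second_moment hn]
  have hn0 : (0 : ℝ) < n := by positivity
  have hs : √(n : ℝ) ≠ 0 := (Real.sqrt_pos.2 hn0).ne'
  generalize ∑ k ∈ range (n + 1), mlynarTail n k = S
  have hsq : (n : ℝ) = √n ^ 2 := (Real.sq_sqrt hn0.le).symm
  generalize √(n : ℝ) = r at hs hsq ⊢
  rw [hsq]
  field_simp
  ring
end

section
/- If n ≥ 1 is a natural number that is not of the form (m−1)·m for any natural number m, then the Mlynar distribution with parameter n has the unique mode m = ⌊1/2 + √(1/4 + n)⌋, i.e., p_{m,n} > p_{k,n} for every k with 1 ≤ k ≤ n and k ≠ m. -/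
open Finset Real Filter

theorem mlynarP_pos {n k : ℕ} (hk : 1 ≤ k) (hkn : k ≤ n) : 0 < mlynarP n k := by
  have hn : (0 : ℝ) < n := by exact_mod_cast hk.trans hkn
  have hk' : (0 : ℝ) < k := by exact_mod_cast hk
  unfold mlynarP
  positivity

/-- The ratio of consecutive probabilities, in cleared-denominator form. -/
theorem mlynarP_succ_mul {n k : ℕ} (hkn : k < n) :
    mlynarP n (k + 1) * (k * n) = mlynarP n k * ((k + 1) * (n - k)) := by
  obtain ⟨d, rfl⟩ : ∃ d, n = k + 1 + d := ⟨n - (k + 1), by omega⟩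
  have h₁ : k + 1 + d - (k + 1) = d := by omega
  have h₂ : k + 1 + d - k = d + 1 := by omega
  have hn : ((k + 1 + d : ℕ) : ℝ) ≠ 0 := by positivity
  have hd : (d.factorial : ℝ) ≠ 0 := by positivity
  have hd' : (d : ℝ) + 1 ≠ 0 := by positivity
  unfold mlynarP
  rw [h₁, h₂, Nat.factorial_succ, pow_succ]
  generalize ((k + 1 + d - 1).factorial : ℝ) = F
  have hsub : ((k + 1 + d : ℕ) : ℝ) - k = d + 1 := by push_cast; ring
  rw [hsub]
  generalize ((k + 1 + d : ℕ) : ℝ) = N at *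
  push_cast
  field_simp

theorem mlynarP_lt_succ {n k : ℕ} (hk : 1 ≤ k) (h : k * (k + 1) < n) :
    mlynarP n k < mlynarP n (k + 1) := by
  have hkn : k < n := by nlinarith
  have hpos := mlynarP_pos hk hkn.le
  have hkn' : (0 : ℝ) < k * n := by exact_mod_cast Nat.mul_pos hk (by omega)
  have h' : (k : ℝ) * (k + 1) < n := by exact_mod_cast h
  refine lt_of_mul_lt_mul_right ?_ hkn'.le
  rw [mlynarP_succ_mul hkn]
  exact mul_lt_mul_of_pos_left (by linarith) hpos

theorem mlynarP_succ_lt {n k : ℕ} (hk : 1 ≤ k) (hkn : k < n) (h : n < k * (k + 1)) :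
    mlynarP n (k + 1) < mlynarP n k := by
  have hpos := mlynarP_pos hk hkn.le
  have hkn' : (0 : ℝ) < k * n := by exact_mod_cast Nat.mul_pos hk (by omega)
  have h' : (n : ℝ) < k * (k + 1) := by exact_mod_cast h
  refine lt_of_mul_lt_mul_right ?_ hkn'.le
  rw [mlynarP_succ_mul hkn]
  exact mul_lt_mul_of_pos_left (by linarith) hpos

theorem mlynarP_lt_of_lt {n k m : ℕ} (hk : 1 ≤ k) (hkm : k < m) (hm : (m - 1) * m < n) :
    mlynarP n k < mlynarP n m := by
  induction m, hkm using Nat.le_induction with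
  | base => exact mlynarP_lt_succ hk hm
  | succ j hj ih =>
    have hm' : j * (j + 1) < n := hm
    exact (ih ((Nat.mul_le_mul (Nat.sub_le j 1) j.le_succ).trans_lt hm')).trans
      (mlynarP_lt_succ (by omega) hm')

theorem mlynarP_lt_of_gt {n k m : ℕ} (hm : 1 ≤ m) (hmk : m < k) (hkn : k ≤ n)
    (h : n < m * (m + 1)) : mlynarP n k < mlynarP n m := by
  induction k, hmk using Nat.le_induction with
  | base => exact mlynarP_succ_lt hm hkn h
  | succ j hj ih =>
    have hmj : m ≤ j := by omega
    exact (mlynarP_succ_lt (by omega) hkn (h.trans_le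
      (Nat.mul_le_mul hmj (Nat.succ_le_succ hmj)))).trans (ih (by omega))

theorem mlynar_unique_mode (n : ℕ) (hn : 1 ≤ n) (h : ¬ ∃ m : ℕ, n = (m - 1) * m) :
    ∀ k : ℕ, 1 ≤ k → k ≤ n →
      k ≠ Nat.floor ((1 : ℝ) / 2 + Real.sqrt (1 / 4 + n)) →
      mlynarP n k < mlynarP n (Nat.floor ((1 : ℝ) / 2 + Real.sqrt (1 / 4 + n))) := by
  intro k hk hkn hne
  have hs := Real.sq_sqrt (show (0 : ℝ) ≤ 1 / 4 + n by positivity)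
  have hn' : (1 : ℝ) ≤ n := by exact_mod_cast hn
  have hs₁ : (1 : ℝ) / 2 ≤ √(1 / 4 + n) := Real.le_sqrt_of_sq_le (by linarith)
  have hle := Nat.floor_le (show (0 : ℝ) ≤ 1 / 2 + √(1 / 4 + n) by positivity)
  have hlt := Nat.lt_floor_add_one ((1 : ℝ) / 2 + √(1 / 4 + n))
  have hm : 1 ≤ ⌊(1 : ℝ) / 2 + √(1 / 4 + n)⌋₊ :=
    Nat.le_floor (by push_cast; linarith)
  generalize ⌊(1 : ℝ) / 2 + √(1 / 4 + n)⌋₊ = m at *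
  have hm' : (1 : ℝ) ≤ m := by exact_mod_cast hm
  have hlower : (m - 1) * m ≤ n := by
    have : ((m : ℝ) - 1) * m ≤ n := by nlinarith
    rw [← Nat.cast_pred hm] at this
    exact_mod_cast this
  have hupper : n < m * (m + 1) := by
    have : (n : ℝ) < m * (m + 1) := by nlinarith
    exact_mod_cast this
  rcases lt_or_gt_of_ne hne with hkm | hmk
  · exact mlynarP_lt_of_lt hk hkm (lt_of_le_of_ne hlower fun e => h ⟨m, e.symm⟩)
  · exact mlynarP_lt_of_gt hm hmk hkn hupper
end
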